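/- For a finite reflection group W acting orthogonally on ℝ^n with basic homogeneous invariant polynomials p_1,…,p_n of degrees k_1,…,k_n, the number of reflections (distinct from the identity) in W equals ∑_{i=1}^n (k_i − 1). -/

import Mathlib

open scoped BigOperators
open MvPolynomial

noncomputable section

abbrev En (n : ℕ) := EuclideanSpace ℝ (Fin n)

/-- A reflection: an involutive orthogonal transformation, different from the identity,
whose fixed-point set is a hyperplane (has dimension `n - 1`). -/
def IsReflection {n : ℕ} (τ : En n ≃ₗᵢ[ℝ] En n) : Prop :=
  τ ≠ 1 ∧ τ * τ = 1 ∧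
    Module.finrank ℝ
      (LinearMap.eqLocus τ.toLinearEquiv.toLinearMap (LinearMap.id (R := ℝ) (M := En n)))
      = n - 1

/-- A polynomial is `W`-invariant if it is invariant under every element of `W`. -/
def InvariantPoly {n : ℕ} (W : Subgroup (En n ≃ₗᵢ[ℝ] En n))
    (q : MvPolynomial (Fin n) ℝ) : Prop :=
  ∀ w ∈ W, ∀ x : En n,
    MvPolynomial.eval (fun i => w x i) q = MvPolynomial.eval (fun i => x i) q

open scoped TensorProduct

theorem core_lemma {S G : Type*} [CommRing S] [Algebra ℝ S] [Fintype G] [DecidableEq G]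
    (σ : G → S →ₐ[ℝ] S) (D : Derivation ℝ S S) (I : Ideal S)
    (hD : ∀ y, D (∑ u, σ u y) ∈ I) (H : Finset G) (s : S) (hs : ∀ u ∈ H, σ u s = s)
    (b : G → S) :
    (∑ u ∈ H, ∏ w ∈ Hᶜ, (σ w (b w) - σ u (b w)) ^ 2) * D s ∈ I := by
  let m : G → (S ⊗[ℝ] S →ₐ[ℝ] S) := fun u =>
    Algebra.TensorProduct.lift (AlgHom.id ℝ S) (σ u) (fun _ _ => Commute.all _ _)
  have hm : ∀ u x y, m u (x ⊗ₜ y) = x * σ u y := by intro u x y; simp [m]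
  let δ : G → (S ⊗[ℝ] S →ₗ[ℝ] S) := fun u =>
    (LinearMap.mul' ℝ S) ∘ₗ (TensorProduct.map (D : S →ₗ[ℝ] S) (σ u).toLinearMap)
  have hδ : ∀ u x y, δ u (x ⊗ₜ y) = D x * σ u y := by intro u x y; simp [δ]
  have hmul : ∀ u e e', δ u (e * e') = m u e * δ u e' + m u e' * δ u e := by
    intro u e e'
    induction e with
    | zero => simp
    | add a b ha hb => rw [add_mul, map_add, ha, hb, map_add, map_add]; ring
    | tmul x y =>
      induction e' with
      | zero => simp
      | add a b ha hb => rw [mul_add, map_add, ha, hb, map_add, map_add]; ring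
      | tmul x' y' =>
        rw [Algebra.TensorProduct.tmul_mul_tmul]
        simp only [hm, hδ, Derivation.leibniz, map_mul, smul_eq_mul]; ring
  have key : ∀ (t : S) e, D (∑ u, m u e * σ u t) - ∑ u, δ u e * σ u t ∈ I := by
    intro t e
    induction e with
    | zero => simp
    | add a b ha hb =>
      have := I.add_mem ha hb
      simp only [map_add, add_mul, Finset.sum_add_distrib] at this ⊢
      convert this using 1; ring
    | tmul x y =>
      have h1 : ∑ u, m u (x ⊗ₜ y) * σ u t = x * ∑ u, σ u (y * t) := by
        rw [Finset.mul_sum]; refine Finset.sum_congr rfl fun u _ => ?_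
        rw [hm, map_mul]; ring
      have h2 : ∑ u, δ u (x ⊗ₜ y) * σ u t = D x * ∑ u, σ u (y * t) := by
        rw [Finset.mul_sum]; refine Finset.sum_congr rfl fun u _ => ?_
        rw [hδ, map_mul]; ring
      rw [h1, h2, Derivation.leibniz, smul_eq_mul, smul_eq_mul]
      have := I.mul_mem_left x (hD (y * t))
      convert this using 1; ring
  let e0 : S ⊗[ℝ] S := ∏ w ∈ Hᶜ, (σ w (b w) ⊗ₜ 1 - 1 ⊗ₜ b w)
  have hme0 : ∀ u, m u e0 = ∏ w ∈ Hᶜ, (σ w (b w) - σ u (b w)) := by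
    intro u; simp only [e0, map_prod, map_sub, hm, map_one, mul_one, one_mul]
  have hz : ∀ u, u ∉ H → m u e0 = 0 := by
    intro u hu; rw [hme0]
    exact Finset.prod_eq_zero (Finset.mem_compl.2 hu) (sub_self _)
  have e1 : ∀ t, (∀ u ∈ H, σ u t = t) →
      ∑ u, m u (e0 * e0) * σ u t = (∑ u ∈ H, m u (e0 * e0)) * t := by
    intro t ht
    rw [Finset.sum_mul, ← Finset.sum_subset (Finset.subset_univ H)]
    · exact Finset.sum_congr rfl fun u hu => by rw [ht u hu]
    · intro u _ hu; rw [map_mul, hz u hu]; ring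
  have e2 : ∀ t, (∀ u ∈ H, σ u t = t) →
      ∑ u, δ u (e0 * e0) * σ u t = (∑ u ∈ H, δ u (e0 * e0)) * t := by
    intro t ht
    rw [Finset.sum_mul, ← Finset.sum_subset (Finset.subset_univ H)]
    · exact Finset.sum_congr rfl fun u hu => by rw [ht u hu]
    · intro u _ hu; rw [hmul, hz u hu]; ring
  have k1 := key s (e0 * e0)
  have k2 := key 1 (e0 * e0)
  rw [e1 s hs, e2 s hs] at k1
  rw [e1 1 (by simp), e2 1 (by simp), mul_one, mul_one] at k2
  have h3 : ∑ u ∈ H, ∏ w ∈ Hᶜ, (σ w (b w) - σ u (b w)) ^ 2 = ∑ u ∈ H, m u (e0 * e0) := by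
    refine Finset.sum_congr rfl fun u _ => ?_
    rw [map_mul, hme0, Finset.prod_pow, sq]
  rw [h3]
  have := I.sub_mem k1 (I.mul_mem_left s k2)
  rw [Derivation.leibniz, smul_eq_mul, smul_eq_mul] at this
  convert this using 1; ring

/-- The linear form attached to a vector. -/
def lin {n : ℕ} (a : En n) : MvPolynomial (Fin n) ℝ := ∑ i, C (a i) * X i

theorem eval_lin {n : ℕ} (a x : En n) : eval (fun i => x i) (lin a) = inner ℝ a x := by
  simp [lin, PiLp.inner_apply, mul_comm]

theorem lin_sub {n : ℕ} (a b : En n) : lin (a - b) = lin a - lin b := by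
  simp [lin, sub_mul, Finset.sum_sub_distrib]

theorem lin_smul {n : ℕ} (t : ℝ) (a : En n) : lin (t • a) = C t * lin a := by
  simp [lin, Finset.mul_sum, mul_assoc]

theorem lin_single {n : ℕ} (i : Fin n) : lin (EuclideanSpace.single i (1 : ℝ)) = X i := by
  classical
  rw [lin, Finset.sum_eq_single i]
  · simp
  · intro j _ hj; simp [hj]
  · simp

theorem lin_homog {n : ℕ} (a : En n) : (lin a).IsHomogeneous 1 := by
  refine IsHomogeneous.sum _ _ _ fun i _ => ?_
  simpa using (isHomogeneous_C (Fin n) (a i)).mul (isHomogeneous_X ℝ i)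

theorem lin_ne_zero {n : ℕ} {a : En n} (ha : a ≠ 0) : lin a ≠ 0 := by
  intro h
  have := eval_lin a a
  rw [h] at this
  rw [map_zero] at this
  exact ha (inner_self_eq_zero.1 this.symm)

theorem lin_prime {n : ℕ} {a : En n} (ha : a ≠ 0) : Prime (lin a) := by
  rw [← irreducible_iff_prime]
  apply irreducible_of_totalDegree_eq_one
  · exact (lin_homog a).totalDegree (lin_ne_zero ha)
  · intro x hx
    rw [isUnit_iff_ne_zero]
    rintro rfl
    apply lin_ne_zero ha
    ext i
    simpa using hx i

theorem lin_dvd_lin {n : ℕ} {a b : En n} (ha : ‖a‖ = 1) (h : lin a ∣ lin b) :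
    b = (inner ℝ a b : ℝ) • a := by
  obtain ⟨q, hq⟩ := h
  set x : En n := b - (inner ℝ a b : ℝ) • a with hx
  have hax : inner ℝ a x = 0 := by
    rw [hx, inner_sub_right, inner_smul_right, real_inner_self_eq_norm_sq, ha]; ring
  have hbx : inner ℝ b x = 0 := by
    rw [← eval_lin, hq, map_mul, eval_lin, hax, zero_mul]
  have : inner ℝ x x = 0 := by
    conv_lhs => rw [hx]
    rw [← hx, inner_sub_left, inner_smul_left, hbx, hax]; simp
  rw [inner_self_eq_zero] at this
  exact sub_eq_zero.1 this

/-- The substitution action of an isometry on polynomials. -/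
def act {n : ℕ} (w : En n ≃ₗᵢ[ℝ] En n) : MvPolynomial (Fin n) ℝ →ₐ[ℝ] MvPolynomial (Fin n) ℝ :=
  aeval (fun i => lin (w.symm (EuclideanSpace.single i 1)))

theorem inner_symm_single {n : ℕ} (w : En n ≃ₗᵢ[ℝ] En n) (x : En n) (i : Fin n) :
    inner ℝ (w.symm (EuclideanSpace.single i 1)) x = w x i := by
  rw [← w.inner_map_map, w.apply_symm_apply]
  simp [EuclideanSpace.inner_single_left]

theorem eval_act {n : ℕ} (w : En n ≃ₗᵢ[ℝ] En n) (q : MvPolynomial (Fin n) ℝ) (x : En n) :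
    eval (fun i => x i) (act w q) = eval (fun i => w x i) q := by
  induction q using MvPolynomial.induction_on with
  | C r => simp [act]
  | add p q hp hq => simp [hp, hq]
  | mul_X p i hp =>
    have h1 : act w (X i) = lin (w.symm (EuclideanSpace.single i 1)) := by simp [act]
    rw [map_mul, map_mul, map_mul, hp, h1, eval_lin, inner_symm_single, eval_X]

theorem poly_ext {n : ℕ} {p q : MvPolynomial (Fin n) ℝ}
    (h : ∀ x : En n, eval (fun i => x i) p = eval (fun i => x i) q) : p = q := by
  apply MvPolynomial.funext
  intro x
  exact h (WithLp.toLp 2 x)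

theorem act_act {n : ℕ} (u v : En n ≃ₗᵢ[ℝ] En n) (q : MvPolynomial (Fin n) ℝ) :
    act u (act v q) = act (v * u) q := by
  apply poly_ext
  intro x
  rw [eval_act, eval_act, eval_act]; rfl

theorem act_one {n : ℕ} (q : MvPolynomial (Fin n) ℝ) : act (1 : En n ≃ₗᵢ[ℝ] En n) q = q := by
  apply poly_ext
  intro x
  rw [eval_act]; rfl

theorem invariant_iff {n : ℕ} (W : Subgroup (En n ≃ₗᵢ[ℝ] En n)) (q : MvPolynomial (Fin n) ℝ) :
    InvariantPoly W q ↔ ∀ w ∈ W, act w q = q := by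
  constructor
  · intro h w hw
    apply poly_ext
    intro x
    rw [eval_act, h w hw]
  · intro h w hw x
    rw [← eval_act, h w hw]

theorem act_lin {n : ℕ} (w : En n ≃ₗᵢ[ℝ] En n) (b : En n) : act w (lin b) = lin (w.symm b) := by
  apply poly_ext
  intro x
  have h1 := eval_lin b (w x)
  rw [eval_act, h1, eval_lin, ← w.inner_map_map (w.symm b), w.apply_symm_apply]

theorem refl_of_dvd {n : ℕ} (w : En n ≃ₗᵢ[ℝ] En n) (hw : w ≠ 1) (f : MvPolynomial (Fin n) ℝ)
    (hf : f = 0 ∨ Prime f)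
    (h : ∀ i, f ∣ act w (X i) - X i) :
    ∃ a : En n, ‖a‖ = 1 ∧ (∀ x, w x = x - (2 * inner ℝ a x : ℝ) • a) ∧ Associated f (lin a) := by
  have h' : ∀ i, act w (X i) - X i =
      lin (w.symm (EuclideanSpace.single i 1) - EuclideanSpace.single i 1) := by
    intro i
    rw [lin_sub, lin_single]; simp [act]
  have hex : ∃ i, w.symm (EuclideanSpace.single i 1) - EuclideanSpace.single i (1 : ℝ) ≠ 0 := by
    by_contra hcon
    push Not at hcon
    apply hw
    ext x i
    rw [← inner_symm_single, sub_eq_zero.1 (hcon i), EuclideanSpace.inner_single_left]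
    simp
  obtain ⟨i₀, hi₀⟩ := hex
  set c : En n := w.symm (EuclideanSpace.single i₀ 1) - EuclideanSpace.single i₀ (1 : ℝ) with hc
  have hfc : f ∣ lin c := by rw [hc, ← h']; exact h i₀
  have hfp : Prime f := by
    rcases hf with rfl | hf
    · exact absurd (zero_dvd_iff.1 hfc) (lin_ne_zero hi₀)
    · exact hf
  have hcn : ‖c‖ ≠ 0 := norm_ne_zero_iff.2 hi₀
  obtain ⟨a, ha⟩ : ∃ a : En n, a = ‖c‖⁻¹ • c := ⟨_, rfl⟩
  have ha1 : ‖a‖ = 1 := by rw [ha, norm_smul, norm_inv, norm_norm, inv_mul_cancel₀ hcn]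
  have hca : Associated (lin c) (lin a) := by
    rw [ha, lin_smul]
    have hu : IsUnit (C (‖c‖⁻¹) : MvPolynomial (Fin n) ℝ) :=
      (isUnit_iff_ne_zero.2 (inv_ne_zero hcn)).map C
    exact (associated_unit_mul_left _ _ hu).symm
  have hfa : Associated f (lin a) :=
    (hfp.associated_of_dvd (lin_prime hi₀) hfc).trans hca
  refine ⟨a, ha1, ?_, hfa⟩
  have hrow : ∀ i, ∃ t : ℝ,
      w.symm (EuclideanSpace.single i 1) - EuclideanSpace.single i (1 : ℝ) = t • a := by
    intro i
    refine ⟨_, lin_dvd_lin ha1 ?_⟩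
    rw [← h']
    exact hfa.symm.dvd.trans (h i)
  choose t ht using hrow
  set d : En n := WithLp.toLp 2 t with hd
  have hwd : ∀ x, w x = x + (inner ℝ a x : ℝ) • d := by
    intro x
    ext i
    rw [← inner_symm_single, eq_add_of_sub_eq (ht i), inner_add_left, inner_smul_left,
      EuclideanSpace.inner_single_left]
    simp [hd]; ring
  have haa : inner ℝ a a = (1 : ℝ) := by rw [real_inner_self_eq_norm_sq, ha1]; norm_num
  have h1 : ∀ x, inner ℝ a x = (0 : ℝ) → inner ℝ x d = (0 : ℝ) := by
    intro x hx
    have := w.inner_map_map x a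
    rw [hwd x, hwd a, hx, haa, zero_smul, one_smul, add_zero, inner_add_right] at this
    linarith
  have h2 : d = (inner ℝ a d : ℝ) • a := by
    have e1 : inner ℝ a (d - (inner ℝ a d : ℝ) • a) = (0 : ℝ) := by
      rw [inner_sub_right, inner_smul_right, haa]; ring
    have e2 := h1 _ e1
    have e3 : inner ℝ (d - (inner ℝ a d : ℝ) • a) (d - (inner ℝ a d : ℝ) • a) = (0 : ℝ) := by
      rw [inner_sub_right, e2, inner_smul_right, real_inner_comm a, e1]; ring
    rw [inner_self_eq_zero] at e3
    exact sub_eq_zero.1 e3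
  set l : ℝ := inner ℝ a d with hl
  have h3 : l * (l + 2) = 0 := by
    have := w.inner_map_map a a
    have e : w a = (1 + l) • a := by rw [hwd, haa, one_smul, add_smul, one_smul, ← h2]
    rw [e, inner_smul_left, inner_smul_right, haa] at this
    simp only [conj_trivial] at this
    linarith
  have h4 : l ≠ 0 := by
    intro h0
    apply hw
    ext x i
    rw [hwd, h2, h0]; simp
  have h5 : l = -2 := by
    rcases mul_eq_zero.1 h3 with h | h
    · exact absurd h h4
    · linarith
  intro x
  rw [hwd, h2, h5, smul_smul, sub_eq_add_neg, ← neg_smul]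
  congr 2; ring

theorem refl_unique {n : ℕ} {w w' : En n ≃ₗᵢ[ℝ] En n} {a a' : En n} (ha : ‖a‖ = 1) (ha' : ‖a'‖ = 1)
    (hw : ∀ x, w x = x - (2 * inner ℝ a x : ℝ) • a)
    (hw' : ∀ x, w' x = x - (2 * inner ℝ a' x : ℝ) • a')
    (h : lin a ∣ lin a') : w = w' := by
  have h1 := lin_dvd_lin ha h
  set t : ℝ := inner ℝ a a' with ht
  have h2 : t * t = 1 := by
    have : inner ℝ a' a' = (1 : ℝ) := by rw [real_inner_self_eq_norm_sq, ha']; norm_num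
    rw [h1, inner_smul_left, inner_smul_right, real_inner_self_eq_norm_sq, ha] at this
    simpa using this
  refine LinearIsometryEquiv.ext fun x => ?_
  rw [hw, hw', h1, inner_smul_left, smul_smul]
  congr 2
  simp only [conj_trivial]
  linear_combination (-2 * inner ℝ a x) * h2

theorem isReflection_iff {n : ℕ} (w : En n ≃ₗᵢ[ℝ] En n) :
    IsReflection w ↔ ∃ a : En n, ‖a‖ = 1 ∧ ∀ x, w x = x - (2 * inner ℝ a x : ℝ) • a := by
  set F : Submodule ℝ (En n) :=
    LinearMap.eqLocus w.toLinearEquiv.toLinearMap (LinearMap.id (R := ℝ) (M := En n)) with hF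
  have hmem : ∀ x, x ∈ F ↔ w x = x := by intro x; simp [hF, LinearMap.mem_eqLocus]
  have hdim : Module.finrank ℝ F + Module.finrank ℝ Fᗮ = n := by
    rw [F.finrank_add_finrank_orthogonal]; simp
  constructor
  · rintro ⟨h1, h2, h3⟩
    rw [← hF] at h3
    have hn : n ≠ 0 := by
      rintro rfl
      exact h1 (LinearIsometryEquiv.ext fun x => Subsingleton.elim _ _)
    have h4 : Module.finrank ℝ Fᗮ = 1 := by omega
    obtain ⟨v, hv0, hv⟩ := finrank_eq_one_iff'.1 h4
    have hvn : ‖(v : En n)‖ ≠ 0 := by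
      rw [norm_ne_zero_iff]; simpa using hv0
    set a : En n := ‖(v : En n)‖⁻¹ • (v : En n) with ha
    have ha1 : ‖a‖ = 1 := by rw [ha, norm_smul, norm_inv, norm_norm, inv_mul_cancel₀ hvn]
    have haF : a ∈ Fᗮ := Fᗮ.smul_mem _ v.2
    have hspan : ∀ y ∈ Fᗮ, ∃ c : ℝ, y = c • a := by
      intro y hy
      obtain ⟨c, hc⟩ := hv ⟨y, hy⟩
      refine ⟨c * ‖(v : En n)‖, ?_⟩
      rw [ha, smul_smul, mul_assoc, mul_inv_cancel₀ hvn, mul_one]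
      exact (congrArg Subtype.val hc).symm
    have hww : ∀ x, w (w x) = x := fun x => by
      have := congrArg (fun g : En n ≃ₗᵢ[ℝ] En n => g x) h2
      exact this
    refine ⟨a, ha1, fun x => ?_⟩
    have haa : inner ℝ a a = (1 : ℝ) := by rw [real_inner_self_eq_norm_sq, ha1]; norm_num
    have hx1 : x + w x ∈ F := by rw [hmem, map_add, hww, add_comm]
    have hx2 : x - w x ∈ Fᗮ := by
      rw [Submodule.mem_orthogonal]
      intro u hu
      have := w.inner_map_map u x
      rw [(hmem u).1 hu] at this
      rw [inner_sub_right, this, sub_self]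
    obtain ⟨c, hc⟩ := hspan _ hx2
    have e1 : inner ℝ a (x + w x) = (0 : ℝ) := (Submodule.mem_orthogonal' _ _).1 haF _ hx1
    have e2 : inner ℝ a (x - w x) = c := by rw [hc, inner_smul_right, haa, mul_one]
    rw [inner_add_right] at e1
    rw [inner_sub_right] at e2
    have : c = 2 * inner ℝ a x := by linarith
    rw [← this, ← hc]; abel
  · rintro ⟨a, ha, hw⟩
    have haa : inner ℝ a a = (1 : ℝ) := by rw [real_inner_self_eq_norm_sq, ha]; norm_num
    have ha0 : a ≠ 0 := by rintro rfl; simp at ha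
    refine ⟨?_, ?_, ?_⟩
    · rintro rfl
      have := hw a
      change a = _ at this
      rw [haa, mul_one] at this
      have h2 : (2 : ℝ) • a = 0 := sub_eq_self.1 this.symm
      exact ha0 (by simpa using h2)
    · refine LinearIsometryEquiv.ext fun x => ?_
      change w (w x) = x
      rw [hw (w x), hw x, inner_sub_right, inner_smul_right, haa, sub_sub, ← add_smul]
      ring_nf
      simp
    · rw [← hF]
      have hFo : F = (ℝ ∙ a)ᗮ := by
        ext x
        rw [hmem, hw, sub_eq_self, Submodule.mem_orthogonal_singleton_iff_inner_right]
        simp [ha0]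
      have : Module.finrank ℝ (ℝ ∙ a) + Module.finrank ℝ F = n := by
        rw [hFo, Submodule.finrank_add_finrank_orthogonal]; simp
      rw [finrank_span_singleton ha0] at this
      omega

theorem mkDer_apply {n : ℕ} (V : Fin n → MvPolynomial (Fin n) ℝ) (q : MvPolynomial (Fin n) ℝ) :
    mkDerivation ℝ V q = ∑ j, pderiv j q * V j := by
  classical
  induction q using MvPolynomial.induction_on with
  | C r => simp
  | add p q hp hq => simp [hp, hq, add_mul, Finset.sum_add_distrib]
  | mul_X p i hp =>
    rw [Derivation.leibniz, hp, mkDerivation_X]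
    simp only [Derivation.leibniz, smul_eq_mul, add_mul, Finset.sum_add_distrib, pderiv_X,
      Finset.mul_sum]
    congr 1
    · rw [Finset.sum_eq_single i]
      · simp
      · intro j _ hj; simp [hj.symm]
      · simp
    · exact Finset.sum_congr rfl fun j _ => by ring

theorem mkDer_lin {n : ℕ} (V : Fin n → MvPolynomial (Fin n) ℝ) (b : En n) :
    mkDerivation ℝ V (lin b) = ∑ j, C (b j) * V j := by
  simp only [lin, map_sum, Derivation.leibniz, mkDerivation_X, derivation_C, smul_eq_mul,
    mul_zero, add_zero]

/-- The Jacobian matrix. -/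
def jac {n : ℕ} (p : Fin n → MvPolynomial (Fin n) ℝ) : Matrix (Fin n) (Fin n) (MvPolynomial (Fin n) ℝ) :=
  Matrix.of fun i j => pderiv j (p i)

theorem mkDer_jac {n : ℕ} (p : Fin n → MvPolynomial (Fin n) ℝ)
    (V : Fin n → MvPolynomial (Fin n) ℝ) (i : Fin n) :
    mkDerivation ℝ V (p i) = (jac p).mulVec V i := by
  rw [mkDer_apply]; rfl

theorem der_adjoin {n : ℕ} (p : Fin n → MvPolynomial (Fin n) ℝ)
    (D : Derivation ℝ (MvPolynomial (Fin n) ℝ) (MvPolynomial (Fin n) ℝ))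
    (I : Ideal (MvPolynomial (Fin n) ℝ)) (h : ∀ i, D (p i) ∈ I) (q : MvPolynomial (Fin n) ℝ)
    (hq : q ∈ Algebra.adjoin ℝ (Set.range p)) : D q ∈ I := by
  induction hq using Algebra.adjoin_induction with
  | mem x hx => obtain ⟨i, rfl⟩ := hx; exact h i
  | algebraMap r => simp
  | add x y _ _ hx hy => rw [map_add]; exact I.add_mem hx hy
  | mul x y _ _ hx hy =>
    rw [Derivation.leibniz]; exact I.add_mem (I.mul_mem_left _ hy) (I.mul_mem_left _ hx)

theorem span_isPrime {n : ℕ} {f : MvPolynomial (Fin n) ℝ} (hf : f = 0 ∨ Prime f) :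
    (Ideal.span {f}).IsPrime := by
  rcases hf with rfl | hf
  · simpa using Ideal.isPrime_bot
  · exact (Ideal.span_singleton_prime hf.ne_zero).2 hf

theorem exists_kernel {n : ℕ} {f : MvPolynomial (Fin n) ℝ} (hf : f = 0 ∨ Prime f)
    (M : Matrix (Fin n) (Fin n) (MvPolynomial (Fin n) ℝ)) (h : f ∣ M.det) :
    ∃ v : Fin n → MvPolynomial (Fin n) ℝ, (∃ j, ¬ f ∣ v j) ∧ ∀ i, f ∣ M.mulVec v i := by
  have := span_isPrime hf
  let π := Ideal.Quotient.mk (Ideal.span {f})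
  have hπ : ∀ q, π q = 0 ↔ f ∣ q := fun q => by
    rw [Ideal.Quotient.eq_zero_iff_mem, Ideal.mem_span_singleton]
  have hdet : (π.mapMatrix M).det = 0 := by
    rw [← RingHom.map_det, hπ]; exact h
  obtain ⟨v, hv0, hv⟩ := Matrix.exists_mulVec_eq_zero_iff.2 hdet
  have hs : ∀ j, ∃ q, π q = v j := fun j => Ideal.Quotient.mk_surjective (v j)
  choose q hq using hs
  refine ⟨q, ?_, fun i => ?_⟩
  · by_contra hcon
    push Not at hcon
    apply hv0
    ext j
    rw [← hq j, (hπ _).2 (hcon j)]; rfl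
  · rw [← hπ]
    have := congrFun hv i
    simp only [Matrix.mulVec, dotProduct, map_sum, map_mul] at this ⊢
    simpa [← hq] using this

theorem sum_act_invariant {n : ℕ} (W : Subgroup (En n ≃ₗᵢ[ℝ] En n)) [Fintype W]
    (y : MvPolynomial (Fin n) ℝ) : InvariantPoly W (∑ u : W, act (u : En n ≃ₗᵢ[ℝ] En n) y) := by
  rw [invariant_iff]
  intro w hw
  rw [map_sum]
  simp only [act_act]
  exact Fintype.sum_equiv (Equiv.mulRight (⟨w, hw⟩ : W)) _ _ (fun u => rfl)

theorem inertia {n : ℕ} (W : Subgroup (En n ≃ₗᵢ[ℝ] En n)) [Fintype W]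
    (p : Fin n → MvPolynomial (Fin n) ℝ)
    (hadj : ∀ q : MvPolynomial (Fin n) ℝ,
      InvariantPoly W q → q ∈ Algebra.adjoin ℝ (Set.range p))
    (f : MvPolynomial (Fin n) ℝ) (hf : f = 0 ∨ Prime f) (h : f ∣ (jac p).det) :
    ∃ w ∈ W, w ≠ 1 ∧ ∀ i, f ∣ act w (X i) - X i := by
  classical
  obtain ⟨v, ⟨j, hj⟩, hv⟩ := exists_kernel hf _ h
  by_contra hcon
  push Not at hcon
  have hb : ∀ w : W, ∃ b : MvPolynomial (Fin n) ℝ,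
      w ≠ 1 → ¬ f ∣ act (w : En n ≃ₗᵢ[ℝ] En n) b - b := by
    intro w
    by_cases hw : w = 1
    · exact ⟨0, fun h => absurd hw h⟩
    · obtain ⟨i, hi⟩ := hcon w w.2 (by simpa using hw)
      exact ⟨X i, fun _ => hi⟩
  choose b hb using hb
  have hP := span_isPrime hf
  have := core_lemma (fun u : W => act (u : En n ≃ₗᵢ[ℝ] En n)) (mkDerivation ℝ v) (Ideal.span {f})
    (fun y => der_adjoin p _ _ (fun i => by
      rw [mkDer_jac, Ideal.mem_span_singleton]; exact hv i) _ (hadj _ (sum_act_invariant W y)))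
    {1} (X j) (by simp [act_one]) b
  rw [mkDerivation_X, Finset.sum_singleton] at this
  rcases hP.mem_or_mem this with h1 | h1
  · rw [hP.prod_mem_iff] at h1
    obtain ⟨w, hw, hw2⟩ := h1
    have h3 := hP.mem_of_pow_mem _ hw2
    rw [Ideal.mem_span_singleton] at h3
    refine hb w (by simpa using hw) ?_
    simpa [act_one] using h3
  · exact hj (Ideal.mem_span_singleton.1 h1)

theorem jac_ne_zero {n : ℕ} (W : Subgroup (En n ≃ₗᵢ[ℝ] En n)) [Fintype W]
    (p : Fin n → MvPolynomial (Fin n) ℝ)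
    (hadj : ∀ q : MvPolynomial (Fin n) ℝ,
      InvariantPoly W q → q ∈ Algebra.adjoin ℝ (Set.range p)) : (jac p).det ≠ 0 := by
  intro h
  obtain ⟨w, _, hw1, hw2⟩ := inertia W p hadj 0 (Or.inl rfl) (by rw [h])
  obtain ⟨a, ha, _, hfa⟩ := refl_of_dvd w hw1 0 (Or.inl rfl) hw2
  have ha0 : a ≠ 0 := by rintro rfl; simp at ha
  exact lin_ne_zero ha0 (zero_dvd_iff.1 hfa.dvd)

theorem prime_factor {n : ℕ} (W : Subgroup (En n ≃ₗᵢ[ℝ] En n)) [Fintype W]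
    (p : Fin n → MvPolynomial (Fin n) ℝ)
    (hadj : ∀ q : MvPolynomial (Fin n) ℝ,
      InvariantPoly W q → q ∈ Algebra.adjoin ℝ (Set.range p))
    (f : MvPolynomial (Fin n) ℝ) (hf : Prime f) (h : f ∣ (jac p).det) :
    ∃ w ∈ W, ∃ a : En n, ‖a‖ = 1 ∧ (∀ x, w x = x - (2 * inner ℝ a x : ℝ) • a) ∧
      Associated f (lin a) := by
  obtain ⟨w, hw, hw1, hw2⟩ := inertia W p hadj f (Or.inr hf) h
  exact ⟨w, hw, refl_of_dvd w hw1 f (Or.inr hf) hw2⟩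

theorem lin_dvd_act_sub {n : ℕ} {w : En n ≃ₗᵢ[ℝ] En n} {a : En n}
    (hw : ∀ x, w x = x - (2 * inner ℝ a x : ℝ) • a) (q : MvPolynomial (Fin n) ℝ) :
    lin a ∣ act w q - q := by
  induction q using MvPolynomial.induction_on with
  | C r => simp [act]
  | add p q hp hq =>
    rw [map_add, add_sub_add_comm]; exact dvd_add hp hq
  | mul_X p i hp =>
    have h1 : act w (X i) - X i = lin a * C (-2 * a i) := by
      apply poly_ext
      intro x
      rw [map_sub, map_mul, eval_act, eval_lin, eval_X, eval_X, hw, eval_C]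
      simp; ring
    have : act w (p * X i) - p * X i = (act w p - p) * act w (X i) + p * (act w (X i) - X i) := by
      rw [map_mul]; ring
    rw [this, h1]
    exact dvd_add (dvd_mul_of_dvd_left hp _) (dvd_mul_of_dvd_right (dvd_mul_right _ _) _)

/-- The derivation in direction of `a`. -/
def dirD {n : ℕ} (a : En n) : Derivation ℝ (MvPolynomial (Fin n) ℝ) (MvPolynomial (Fin n) ℝ) :=
  mkDerivation ℝ (fun j => C (a j))

theorem sum_sq {n : ℕ} {a : En n} (ha : ‖a‖ = 1) :
    ∑ j, (C (a j) * C (a j) : MvPolynomial (Fin n) ℝ) = 1 := by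
  have : ∑ j, a j * a j = (1 : ℝ) := by
    have h := real_inner_self_eq_norm_sq a
    rw [ha, one_pow, PiLp.inner_apply] at h
    simpa [sq] using h
  simp only [← map_mul, ← map_sum, this, map_one]

theorem act_root {n : ℕ} {w : En n ≃ₗᵢ[ℝ] En n} {a : En n} (ha : ‖a‖ = 1)
    (hw : ∀ x, w x = x - (2 * inner ℝ a x : ℝ) • a) : act w (lin a) = - lin a := by
  have haa : inner ℝ a a = (1 : ℝ) := by rw [real_inner_self_eq_norm_sq, ha]; norm_num
  have h2 : w.symm a = -a := by
    rw [LinearIsometryEquiv.symm_apply_eq, hw, inner_neg_right, haa]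
    module
  have h3 : -a = (-1 : ℝ) • a := by module
  rw [act_lin, h2, h3, lin_smul]; simp

theorem two_isUnit {n : ℕ} : IsUnit (2 : MvPolynomial (Fin n) ℝ) := by
  rw [← map_ofNat (C : ℝ →+* MvPolynomial (Fin n) ℝ) 2]
  exact (isUnit_iff_ne_zero.2 (by norm_num)).map C

theorem dirD_anti {n : ℕ} {w : En n ≃ₗᵢ[ℝ] En n} {a : En n} (ha : ‖a‖ = 1)
    (hw : ∀ x, w x = x - (2 * inner ℝ a x : ℝ) • a) (q : MvPolynomial (Fin n) ℝ) :
    dirD a (act w q) = - act w (dirD a q) := by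
  induction q using MvPolynomial.induction_on with
  | C r => simp [act, dirD]
  | add p q hp hq => simp only [map_add, hp, hq]; ring
  | mul_X p i hp =>
    have h1 : act w (X i) = X i - C (2 * a i) * lin a := by
      apply poly_ext
      intro x
      rw [map_sub, map_mul, eval_act, eval_lin, eval_X, eval_X, hw, eval_C]
      simp; ring
    have h2 : dirD a (lin a) = 1 := by
      rw [dirD, mkDer_lin]
      exact sum_sq ha
    have h3 : dirD a (X i) = C (a i) := by rw [dirD, mkDerivation_X]
    have h4 : dirD a (act w (X i)) = - C (a i) := by
      have h5 : dirD a (C (2 * a i)) = 0 := by rw [dirD, derivation_C]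
      rw [h1, map_sub, h3, Derivation.leibniz, h2, h5, map_mul, map_ofNat, smul_eq_mul, smul_eq_mul]
      ring
    have h5 : act w (C (a i)) = C (a i) := by simp [act]
    rw [map_mul, Derivation.leibniz, hp, h4, Derivation.leibniz, h3]
    simp only [smul_eq_mul, map_add, map_mul, h5]
    ring

theorem dirD_dvd {n : ℕ} {w : En n ≃ₗᵢ[ℝ] En n} {a : En n} (ha : ‖a‖ = 1)
    (hw : ∀ x, w x = x - (2 * inner ℝ a x : ℝ) • a) (q : MvPolynomial (Fin n) ℝ)
    (hq : act w q = q) : lin a ∣ dirD a q := by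
  have h1 := dirD_anti ha hw q
  rw [hq] at h1
  obtain ⟨g, hg⟩ := lin_dvd_act_sub hw (dirD a q)
  have h2 : act w (dirD a q) = - dirD a q := by rw [h1, neg_neg, ← h1]
  rw [h2] at hg
  refine ⟨C (-1/2) * g, ?_⟩
  have h3 : (C (-1/2) * (-2) : MvPolynomial (Fin n) ℝ) = 1 := by
    rw [show (-2 : MvPolynomial (Fin n) ℝ) = C (-2) by rw [map_neg, map_ofNat], ← map_mul]; norm_num
  linear_combination (- dirD a q) * h3 + C (-1/2) * hg

theorem jac_factor {n : ℕ} {W : Subgroup (En n ≃ₗᵢ[ℝ] En n)}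
    {p : Fin n → MvPolynomial (Fin n) ℝ} (hinv : ∀ i, InvariantPoly W (p i))
    {w : En n ≃ₗᵢ[ℝ] En n} (hwW : w ∈ W) {a : En n} (ha : ‖a‖ = 1)
    (hw : ∀ x, w x = x - (2 * inner ℝ a x : ℝ) • a) :
    ∃ M : Matrix (Fin n) (Fin n) (MvPolynomial (Fin n) ℝ),
      jac p = M * (1 + Matrix.vecMulVec (fun j => (lin a - 1) * C (a j)) (fun j => C (a j))) ∧ (jac p).det = M.det * lin a := by
  have hg : ∀ i, lin a ∣ dirD a (p i) := fun i =>
    dirD_dvd ha hw _ ((invariant_iff W _).1 (hinv i) w hwW)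
  choose g hg using hg
  have hg' : ∀ i, ∑ j, pderiv j (p i) * C (a j) = lin a * g i := by
    intro i; rw [← hg, dirD, mkDer_apply]
  have haa : ∑ j, (C (a j) * C (a j) : MvPolynomial (Fin n) ℝ) = 1 := sum_sq ha
  let M : Matrix (Fin n) (Fin n) (MvPolynomial (Fin n) ℝ) :=
    Matrix.of fun i j => pderiv j (p i) + (1 - lin a) * g i * C (a j)
  have hM : ∀ i, ∑ j, M i j * C (a j) = g i := by
    intro i
    have : ∀ j, M i j * C (a j) =
        pderiv j (p i) * C (a j) + (1 - lin a) * g i * (C (a j) * C (a j)) := by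
      intro j; simp only [M, Matrix.of_apply]; ring
    simp only [this, Finset.sum_add_distrib, ← Finset.mul_sum, hg', haa]
    ring
  have hfac : jac p = M * (1 + Matrix.vecMulVec (fun j => (lin a - 1) * C (a j)) (fun j => C (a j))) := by
    ext1 i j
    rw [mul_add, mul_one, Matrix.add_apply, Matrix.mul_apply]
    simp only [Matrix.vecMulVec_apply]
    have : ∑ x, M i x * ((lin a - 1) * C (a x) * C (a j)) = (lin a - 1) * g i * C (a j) := by
      rw [← hM i, Finset.mul_sum, Finset.sum_mul]; exact Finset.sum_congr rfl fun x _ => by ring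
    rw [this]
    simp only [M, jac, Matrix.of_apply]; ring
  refine ⟨M, hfac, ?_⟩
  rw [hfac, Matrix.det_mul, Matrix.vecMulVec_eq Unit, Matrix.det_one_add_replicateCol_mul_replicateRow]
  congr 1
  have : (fun j => C (a j)) ⬝ᵥ (fun j => (lin a - 1) * C (a j)) =
      (lin a - 1) * ∑ j, (C (a j) * C (a j) : MvPolynomial (Fin n) ℝ) := by
    rw [dotProduct, Finset.mul_sum]; exact Finset.sum_congr rfl fun x _ => by ring
  rw [this, haa]; ring

theorem sq_not_dvd {n : ℕ} {W : Subgroup (En n ≃ₗᵢ[ℝ] En n)} [Fintype W]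
    {p : Fin n → MvPolynomial (Fin n) ℝ} (hinv : ∀ i, InvariantPoly W (p i))
    (hadj : ∀ q : MvPolynomial (Fin n) ℝ,
      InvariantPoly W q → q ∈ Algebra.adjoin ℝ (Set.range p))
    {w : En n ≃ₗᵢ[ℝ] En n} (hwW : w ∈ W) {a : En n} (ha : ‖a‖ = 1)
    (hw : ∀ x, w x = x - (2 * inner ℝ a x : ℝ) • a) : ¬ lin a * lin a ∣ (jac p).det := by
  classical
  intro hdvd
  have ha0 : a ≠ 0 := by rintro rfl; simp at ha
  have hprime := lin_prime ha0
  have hP := span_isPrime (Or.inr hprime)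
  obtain ⟨M, hM1, hM2⟩ := jac_factor hinv hwW ha hw
  rw [hM2] at hdvd
  have hdM := (mul_dvd_mul_iff_right hprime.ne_zero).1 hdvd
  obtain ⟨v, hv1, hv2⟩ := exists_kernel (Or.inr hprime) M hdM
  have haa : ∑ j, (C (a j) * C (a j) : MvPolynomial (Fin n) ℝ) = 1 := sum_sq ha
  -- the vector field
  set α := lin a with hα
  set t : MvPolynomial (Fin n) ℝ := ∑ j, C (a j) * v j with ht
  let V : Fin n → MvPolynomial (Fin n) ℝ := fun j => α * v j + (1 - α) * t * C (a j)
  have haV : ∑ j, C (a j) * V j = t := by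
    have : ∀ j, C (a j) * V j = α * (C (a j) * v j) + (1 - α) * t * (C (a j) * C (a j)) := by
      intro j; simp only [V]; ring
    simp only [this, Finset.sum_add_distrib, ← Finset.mul_sum, haa, ← ht]; ring
  have hJV : (jac p).mulVec V = α • M.mulVec v := by
    rw [hM1, ← Matrix.mulVec_mulVec, ← Matrix.mulVec_smul]
    congr 1
    rw [Matrix.add_mulVec, Matrix.one_mulVec]
    ext1 j
    have h1 : Matrix.mulVec (Matrix.vecMulVec (fun j => (α - 1) * C (a j)) (fun j => C (a j))) V j
        = (α - 1) * C (a j) * t := by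
      simp only [Matrix.mulVec, dotProduct, Matrix.vecMulVec_apply]
      rw [← haV, Finset.mul_sum]; exact Finset.sum_congr rfl fun x _ => by ring
    rw [Pi.add_apply, h1, Pi.smul_apply, smul_eq_mul]
    simp only [V]
    ring
  -- choice of test polynomials
  let τ : W := ⟨w, hwW⟩
  have hτ1 : (1 : W) ≠ τ := by
    intro h
    have h1 : (1 : En n ≃ₗᵢ[ℝ] En n) = w := congrArg Subtype.val h
    exact ((isReflection_iff w).2 ⟨a, ha, hw⟩).1 h1.symm
  have hb : ∀ u : W, ∃ b : MvPolynomial (Fin n) ℝ,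
      u ∉ ({1, τ} : Finset W) → ¬ α ∣ act (u : En n ≃ₗᵢ[ℝ] En n) b - b := by
    intro u
    by_cases hu : u ∈ ({1, τ} : Finset W)
    · exact ⟨0, fun h => absurd hu h⟩
    · by_contra hcon
      push Not at hcon
      apply hu
      by_cases hu1 : u = 1
      · simp [hu1]
      obtain ⟨a', ha', hw', hass⟩ := refl_of_dvd (u : En n ≃ₗᵢ[ℝ] En n) (by simpa using hu1) α
        (Or.inr hprime) (fun i => (hcon (X i)).2)
      have : w = u := refl_unique ha ha' hw hw' hass.dvd
      have h2 : u = τ := Subtype.ext this.symm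
      simp [h2]
  choose b hb using hb
  set z : MvPolynomial (Fin n) ℝ := ∑ u ∈ ({1, τ} : Finset W), ∏ w ∈ ({1, τ} : Finset W)ᶜ,
      (act (w : En n ≃ₗᵢ[ℝ] En n) (b w) - act (u : En n ≃ₗᵢ[ℝ] En n) (b w)) ^ 2 with hz
  have hzP : ¬ α ∣ z := by
    intro hdz
    rw [hz, Finset.sum_pair hτ1] at hdz
    let π := Ideal.Quotient.mk (Ideal.span {α})
    have hπ : ∀ q, π q = 0 ↔ α ∣ q := fun q => by
      rw [Ideal.Quotient.eq_zero_iff_mem, Ideal.mem_span_singleton]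
    have hπτ : ∀ y, π (act (τ : En n ≃ₗᵢ[ℝ] En n) y) = π y := by
      intro y
      rw [← sub_eq_zero, ← map_sub, hπ]
      exact lin_dvd_act_sub hw y
    rw [← hπ, map_add] at hdz
    simp only [map_prod, map_pow, map_sub, hπτ, OneMemClass.coe_one, act_one] at hdz
    have h2 : (2 : MvPolynomial (Fin n) ℝ ⧸ Ideal.span {α}) ≠ 0 := by
      intro h2
      have h3 : π 2 = 0 := by rw [map_ofNat]; exact h2
      rw [hπ] at h3
      exact hprime.not_isUnit (isUnit_of_dvd_unit h3 two_isUnit)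
    rw [← two_mul, mul_eq_zero] at hdz
    have hdz := hdz.resolve_left h2
    rw [Finset.prod_eq_zero_iff] at hdz
    obtain ⟨u, hu, hu2⟩ := hdz
    have hu3 := pow_eq_zero_iff (two_ne_zero) |>.1 hu2
    rw [← map_sub, hπ] at hu3
    exact hb u (Finset.mem_compl.1 hu) hu3
  have core : ∀ s, act w s = s → α * α ∣ z * mkDerivation ℝ V s := by
    intro s hs
    have := core_lemma (fun u : W => act (u : En n ≃ₗᵢ[ℝ] En n)) (mkDerivation ℝ V)
      (Ideal.span {α * α})
      (fun y => der_adjoin p _ _ (fun i => by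
        rw [mkDer_jac, Ideal.mem_span_singleton, hJV]
        exact mul_dvd_mul_left α (hv2 i)) _ (hadj _ (sum_act_invariant W y)))
      {1, τ} s (by
        intro u hu
        rw [Finset.mem_insert, Finset.mem_singleton] at hu
        rcases hu with rfl | rfl
        · exact act_one s
        · exact hs) b
    rwa [Ideal.mem_span_singleton] at this
  have core' : ∀ s r, act w s = s → mkDerivation ℝ V s = α * r → α ∣ r := by
    intro s r hs hr
    have := core s hs
    rw [hr, mul_left_comm] at this
    exact (hprime.dvd_or_dvd ((mul_dvd_mul_iff_left hprime.ne_zero).1 this)).resolve_left hzP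
  have hsymm : ∀ x, w.symm x = w x := by
    intro x
    rw [LinearIsometryEquiv.symm_apply_eq]
    have := ((isReflection_iff w).2 ⟨a, ha, hw⟩).2.1
    exact (congrArg (fun g : En n ≃ₗᵢ[ℝ] En n => g x) this).symm
  have haa' : inner ℝ a a = (1 : ℝ) := by rw [real_inner_self_eq_norm_sq, ha]; norm_num
  have ht' : α ∣ t := by
    have h1 : act w α = - α := act_root ha hw
    have h2 := core' (α * α) (2 * t) (by rw [map_mul, h1]; ring) (by
      rw [Derivation.leibniz, hα, mkDer_lin, haV, smul_eq_mul]; ring)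
    exact (two_isUnit.dvd_mul_left).1 h2
  obtain ⟨j, hj⟩ := hv1
  apply hj
  set e : En n := EuclideanSpace.single j (1 : ℝ) with he
  have hea : inner ℝ a e = a j := by simp [he, EuclideanSpace.inner_single_right]
  have h1 : act w (lin (e - a j • a)) = lin (e - a j • a) := by
    rw [act_lin, hsymm, hw, inner_sub_right, inner_smul_right, haa', hea]
    simp
  have h2 := core' _ (v j - C (a j) * t) h1 (by
    rw [lin_sub, lin_smul, map_sub, Derivation.leibniz, derivation_C, he, lin_single,
      mkDerivation_X, mkDer_lin, haV]
    simp only [V, smul_eq_mul]; ring)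
  have := dvd_add h2 (dvd_mul_of_dvd_right ht' (C (a j)))
  simpa using this

theorem jac_homog {n : ℕ} {p : Fin n → MvPolynomial (Fin n) ℝ} {k : Fin n → ℕ}
    (hhom : ∀ i, (p i).IsHomogeneous (k i)) :
    (jac p).det.IsHomogeneous (∑ i, (k i - 1)) := by
  rw [← Matrix.det_transpose, Matrix.det_apply]
  refine IsHomogeneous.sum _ _ _ fun σ _ => ?_
  have : (∏ i, (jac p).transpose (σ i) i).IsHomogeneous (∑ i, (k i - 1)) :=
    IsHomogeneous.prod _ _ _ fun i _ => (hhom i).pderiv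
  rcases Int.units_eq_one_or (Equiv.Perm.sign σ) with h | h
  · rw [h, one_smul]; exact this
  · rw [h, Units.neg_smul, one_smul]; exact this.neg

/-- for a finite reflection group `W` on `ℝ^n` with basic homogeneous
invariants `p i` of degrees `k i`, the number of reflections (≠ 1) in `W` is `∑ (k i - 1)`. -/
theorem statement0 {n : ℕ} (W : Subgroup (En n ≃ₗᵢ[ℝ] En n))
    (hfin : (W : Set (En n ≃ₗᵢ[ℝ] En n)).Finite)
    (hgen : Subgroup.closure {τ : En n ≃ₗᵢ[ℝ] En n | τ ∈ W ∧ IsReflection τ} = W)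
    (p : Fin n → MvPolynomial (Fin n) ℝ) (k : Fin n → ℕ)
    (hhom : ∀ i, (p i).IsHomogeneous (k i))
    (hinv : ∀ i, InvariantPoly W (p i))
    (hind : AlgebraicIndependent ℝ p)
    (hadj : ∀ q : MvPolynomial (Fin n) ℝ,
      InvariantPoly W q → q ∈ Algebra.adjoin ℝ (Set.range p)) :
    Nat.card {τ : En n ≃ₗᵢ[ℝ] En n // τ ∈ W ∧ IsReflection τ} = ∑ i, (k i - 1) := by
  classical
  have hWfin : Finite W := hfin
  have hWft : Fintype W := Fintype.ofFinite W
  let R := {τ : En n ≃ₗᵢ[ℝ] En n // τ ∈ W ∧ IsReflection τ}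
  have hRfin : Finite R := (hfin.subset (fun τ hτ => hτ.1) :
    {τ : En n ≃ₗᵢ[ℝ] En n | τ ∈ W ∧ IsReflection τ}.Finite)
  have hRft : Fintype R := Fintype.ofFinite R
  have hroot : ∀ τ : R, ∃ a : En n, ‖a‖ = 1 ∧ ∀ x, τ.1 x = x - (2 * inner ℝ a x : ℝ) • a :=
    fun τ => (isReflection_iff τ.1).1 τ.2.2
  choose a ha hw using hroot
  have ha0 : ∀ τ, a τ ≠ 0 := by
    intro τ h; have := ha τ; rw [h] at this; simp at this
  have hprime : ∀ τ, Prime (lin (a τ)) := fun τ => lin_prime (ha0 τ)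
  have hJ := jac_ne_zero W p hadj
  have hdvd : ∏ τ : R, lin (a τ) ∣ (jac p).det := by
    refine Finset.prod_dvd_of_isRelPrime ?_ ?_
    · intro τ _ τ' _ hne
      rw [Function.onFun, (hprime τ).irreducible.isRelPrime_iff_not_dvd]
      intro h
      exact hne (Subtype.ext (refl_unique (ha τ) (ha τ') (hw τ) (hw τ') h))
    · intro τ _
      obtain ⟨M, _, hM⟩ := jac_factor hinv τ.2.1 (ha τ) (hw τ)
      rw [hM]; exact dvd_mul_left _ _
  obtain ⟨q, hq⟩ := hdvd
  have hq0 : q ≠ 0 := by rintro rfl; simp at hq; exact hJ hq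
  have hqu : IsUnit q := by
    by_contra hnu
    obtain ⟨f, hf, hfq⟩ := WfDvdMonoid.exists_irreducible_factor hnu hq0
    obtain ⟨w, hwW, b, hb, hwb, hass⟩ := prime_factor W p hadj f hf.prime
      (by rw [hq]; exact dvd_mul_of_dvd_right hfq _)
    let τ : R := ⟨w, hwW, (isReflection_iff w).2 ⟨b, hb, hwb⟩⟩
    have h1 : lin (a τ) ∣ f := by
      have : lin b ∣ lin (a τ) := by
        have h := lin_dvd_act_sub hwb (lin (a τ))
        rw [act_root (ha τ) (hw τ)] at h
        have h' : -lin (a τ) - lin (a τ) = -(2 * lin (a τ)) := by ring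
        rw [h', dvd_neg] at h
        exact (two_isUnit.dvd_mul_left).1 h
      have h2 := (lin_prime (by rintro rfl; simp at hb : b ≠ 0)).associated_of_dvd (hprime τ) this
      exact (h2.symm.trans hass.symm).dvd
    refine sq_not_dvd hinv hadj hwW (ha τ) (hw τ) ?_
    rw [hq]
    exact mul_dvd_mul (Finset.dvd_prod_of_mem (fun τ => lin (a τ)) (Finset.mem_univ τ))
      (h1.trans hfq)
  have hqh : q.IsHomogeneous 0 := by
    obtain ⟨c, hc⟩ := (MvPolynomial.isUnit_iff_eq_C_of_isReduced).1 hqu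
    rw [hc.2]; exact isHomogeneous_C _ _
  have h1 : (jac p).det.IsHomogeneous (∑ τ : R, 1 + 0) := by
    rw [hq]
    exact (IsHomogeneous.prod _ _ _ fun τ _ => lin_homog (a τ)).mul hqh
  have h2 := h1.inj_right (jac_homog hhom) hJ
  rw [← h2, Nat.card_eq_fintype_card]
  simp [R]
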